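/- arXiv:1505.03491 — 4 statements merged into one kernel-verified Lean document; each statement's English description precedes it below -/
import Mathlib

section
/- An (n_A, k) Class A code with τ piggybacks per row can correct a minimum of n_A − k − τ + 1 node failures. Precisely: assume the MDS condition holds. Then for every set E ⊆ {0, …, n_A − 1} of column indices with |E| ≤ n_A − k − τ + 1, and for all k×k data matrices D, D′ over F, if the Class A code arrays of D and D′ agree on every column not in E, then D = D′. -/
/-- The Class A encoding: maps a `k × k` data matrix `D` over `F` to the `k × nA` code array.
Column `j < k` stores the data; columns `k ≤ j < nA - τ` are MDS parity columns; columns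
`nA - τ ≤ j < nA` are MDS parity columns with a piggyback `d_{(i+j-nA+τ+1) mod k, i}` added. -/
def classACode (F : Type*) [Field F] (k nA τ : ℕ) (hk : 0 < k)
    (α : Fin k → Fin nA → F) (D : Fin k → Fin k → F) : Fin k → Fin nA → F :=
  fun i j =>
    if hj : (j : ℕ) < k then D i ⟨j, hj⟩
    else if (j : ℕ) < nA - τ then ∑ l : Fin k, α l j * D i l
    else (∑ l : Fin k, α l j * D i l)
      + D ⟨((i : ℕ) + (j : ℕ) + τ + 1 - nA) % k, Nat.mod_lt _ hk⟩ i

/-- The `k × nA` matrix whose first `k` columns are the standard basis vectors of `F^k`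
and whose column `j ≥ k` is `(α_{0,j}, …, α_{k-1,j})ᵀ`. -/
def mdsMat (F : Type*) [Field F] (k nA : ℕ) (α : Fin k → Fin nA → F) :
    Matrix (Fin k) (Fin nA) F :=
  fun i j => if (j : ℕ) < k then (if (i : ℕ) = (j : ℕ) then 1 else 0) else α i j

/-- The MDS condition: every `k` columns of `mdsMat` are linearly independent. -/
def MDSCondition (F : Type*) [Field F] (k nA : ℕ) (α : Fin k → Fin nA → F) : Prop :=
  ∀ S : Finset (Fin nA), S.card = k →
    LinearIndependent F (fun j : {x // x ∈ S} => fun i : Fin k => mdsMat F k nA α i j.1)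

theorem mds_row_zero (F : Type*) [Field F] (k nA : ℕ) (α : Fin k → Fin nA → F)
    (hMDS : MDSCondition F k nA α) (S : Finset (Fin nA)) (hS : k ≤ S.card) (x : Fin k → F)
    (hx : ∀ j ∈ S, ∑ l : Fin k, mdsMat F k nA α l j * x l = 0) : x = 0 := by
  obtain ⟨T, hTS, hT⟩ := Finset.exists_subset_card_eq hS
  have hli := hMDS T hT
  have hspan := hli.span_eq_top_of_card_eq_finrank' (by simp [hT])
  let φ : (Fin k → F) →ₗ[F] F := ∑ l : Fin k, x l • LinearMap.proj l
  have hφ : ∀ y, φ y = ∑ l, x l * y l := by intro y; simp [φ]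
  have h0 : φ = 0 := by
    apply LinearMap.ext_on hspan
    rintro _ ⟨j, rfl⟩
    rw [hφ]
    simpa [mul_comm] using hx j.1 (hTS j.2)
  funext l
  have := hφ (Pi.single l 1)
  rw [h0] at this
  simpa [Pi.single_apply] using this.symm

theorem code_clean (F : Type*) [Field F] (k nA τ : ℕ) (hk : 0 < k) (hn : k ≤ nA - τ)
    (α : Fin k → Fin nA → F) (D : Fin k → Fin k → F) (i : Fin k) (j : Fin nA)
    (hj : (j : ℕ) < nA - τ) :
    classACode F k nA τ hk α D i j = ∑ l : Fin k, mdsMat F k nA α l j * D i l := by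
  unfold classACode mdsMat
  by_cases h : (j : ℕ) < k
  · have : ∀ l : Fin k, ((l : ℕ) = (j : ℕ)) ↔ l = ⟨j, h⟩ := fun l => by rw [Fin.ext_iff]
    simp [h, this]
  · simp [h, hj]

/-- An `(nA, k)` Class A code with `τ` piggybacks per row can correct a
minimum of `nA - k - τ + 1` node failures: if the MDS condition holds, then for any set
`E` of at most `nA - k - τ + 1` column (node) indices, any two data matrices whose Class A
code arrays agree on every column outside `E` must be equal. -/
theorem classA_fault_tolerance (F : Type*) [Field F] (k nA τ : ℕ)
    (hk : 3 ≤ k) (hnA1 : k + 2 ≤ nA) (hnA2 : nA ≤ 2 * k - 1)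
    (hτ1 : 1 ≤ τ) (hτ2 : τ ≤ nA - k - 1)
    (α : Fin k → Fin nA → F) (hMDS : MDSCondition F k nA α) :
    ∀ E : Finset (Fin nA), E.card ≤ nA - k - τ + 1 →
      ∀ D D' : Fin k → Fin k → F,
        (∀ (i : Fin k) (j : Fin nA), j ∉ E →
          classACode F k nA τ (by omega) α D i j = classACode F k nA τ (by omega) α D' i j) →
        D = D' := by
  intro E hE D D' h
  have hk0 : 0 < k := by omega
  have hclean : ∀ i (j : Fin nA), j ∉ E → (j : ℕ) < nA - τ →
      ∑ l : Fin k, mdsMat F k nA α l j * (D i - D' i) l = 0 := by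
    intro i j hj hlt
    have := h i j hj
    rw [code_clean F k nA τ hk0 (by omega) α D i j hlt,
      code_clean F k nA τ hk0 (by omega) α D' i j hlt] at this
    simp only [Pi.sub_apply, mul_sub, Finset.sum_sub_distrib, this, sub_self]
  suffices hX : ∀ i, D i - D' i = 0 by
    funext i; exact sub_eq_zero.1 (hX i)
  let C : Finset (Fin nA) := Finset.univ.filter (fun j => (j : ℕ) < nA - τ)
  have hC : C.card = nA - τ := by
    have : C.card = min nA (nA - τ) := Fin.card_filter_val_lt
    omega
  have hmem : ∀ j, j ∈ C \ E ↔ (j : ℕ) < nA - τ ∧ j ∉ E := by intro j; simp [C]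
  by_cases hA : k ≤ (C \ E).card
  · intro i
    refine mds_row_zero F k nA α hMDS (C \ E) hA _ fun j hj => ?_
    exact hclean i j ((hmem j).1 hj).2 ((hmem j).1 hj).1
  have h1 : (C \ E).card + (E ∩ C).card = C.card := by
    rw [Finset.inter_comm]; exact Finset.card_sdiff_add_card_inter C E
  have h2 : (E ∩ C).card ≤ E.card := Finset.card_le_card Finset.inter_subset_left
  have hEC : E ∩ C = E := Finset.eq_of_subset_of_card_le Finset.inter_subset_left (by omega)
  let j0 : Fin nA := ⟨nA - τ, by omega⟩
  have hj0C : j0 ∉ C := by simp [C, j0]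
  have hj0E : j0 ∉ E := by
    intro hh; rw [← hEC] at hh; exact hj0C (Finset.mem_inter.1 hh).2
  -- the successor row
  let sc : Fin k → Fin k := fun i => ⟨((i : ℕ) + 1) % k, Nat.mod_lt _ hk0⟩
  have hpig : ∀ i, ∑ l : Fin k, mdsMat F k nA α l j0 * (D i - D' i) l
      + (D (sc i) - D' (sc i)) i = 0 := by
    intro i
    have := h i j0 hj0E
    have e1 : ¬ (nA - τ < k) := by omega
    have e2 : (i : ℕ) + (nA - τ) + τ + 1 - nA = i + 1 := by omega
    simp only [classACode, j0, e1, e2, dif_neg, not_false_eq_true, lt_irrefl, if_false] at this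
    simp only [mdsMat, j0, e1, if_false, Pi.sub_apply, mul_sub, Finset.sum_sub_distrib, sc]
    linear_combination this
  have hzero : ∀ i, (D (sc i) - D' (sc i)) i = 0 → D i - D' i = 0 := by
    intro i hi
    have hc : (insert j0 (C \ E)).card = (C \ E).card + 1 :=
      Finset.card_insert_of_notMem (by simp [hj0C])
    refine mds_row_zero F k nA α hMDS (insert j0 (C \ E)) (by omega) _ fun j hj => ?_
    rcases Finset.mem_insert.1 hj with rfl | hj
    · have := hpig i
      rwa [hi, add_zero] at this
    · exact hclean i j ((hmem j).1 hj).2 ((hmem j).1 hj).1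
  -- a surviving data column
  obtain ⟨l, hl⟩ : ∃ l : Fin k, (⟨l, by omega⟩ : Fin nA) ∉ E := by
    by_contra! hcon
    have : (Finset.univ : Finset (Fin k)).card ≤ E.card :=
      Finset.card_le_card_of_injOn (fun l : Fin k => (⟨l, by omega⟩ : Fin nA))
        (fun l _ => hcon l) (fun a _ b _ hab => by
          simp only [Fin.mk.injEq] at hab; exact Fin.ext hab)
    simp at this
    omega
  have hcol : ∀ i, (D i - D' i) l = 0 := by
    intro i
    have := h i _ hl
    simp only [classACode, l.2, dif_pos] at this
    simp only [Pi.sub_apply]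
    exact sub_eq_zero.2 this
  have hdown : ∀ m : ℕ, ∀ i : Fin k, ((i : ℕ) + m) % k = l → D i - D' i = 0 := by
    intro m
    induction m with
    | zero =>
      intro i hi
      have : i = l := Fin.ext (by rwa [add_zero, Nat.mod_eq_of_lt i.2] at hi)
      subst this
      exact hzero i (hcol _)
    | succ m ih =>
      intro i hi
      apply hzero
      rw [ih (sc i) ?_]
      · rfl
      · simp only [sc, Nat.mod_add_mod]
        rw [← hi]; congr 1; omega
  intro i
  apply hdown (l + k - i) i
  rw [show (i : ℕ) + (l + k - i) = l + k by omega, Nat.add_mod_right, Nat.mod_eq_of_lt l.2]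
end

section
/- Since 1 ≤ τ ≤ n_A − k − 1, the Class A code has fault tolerance at least 2: assume the MDS condition holds. Then for every set E ⊆ {0, …, n_A − 1} of column indices with |E| ≤ 2, and for all k×k data matrices D, D′ over F, if the Class A code arrays of D and D′ agree on every column not in E, then D = D′. -/
theorem aux_mds (F : Type*) [Field F] (k nA : ℕ)
    (α : Fin k → Fin nA → F) (hMDS : MDSCondition F k nA α)
    (T : Finset (Fin nA)) (hT : k ≤ T.card) (v : Fin k → F)
    (h : ∀ j ∈ T, ∑ l, mdsMat F k nA α l j * v l = 0) : v = 0 := by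
  obtain ⟨S, hST, hS⟩ := Finset.exists_subset_card_eq hT
  have hli := hMDS S hS
  by_cases hk : k = 0
  · subst hk
    exact Subsingleton.elim _ _
  have : Nonempty {x // x ∈ S} := by
    have : S.Nonempty := by
      rw [← Finset.card_pos]; omega
    exact this.to_subtype
  have hsp := hli.span_eq_top_of_card_eq_finrank (by simp [hS])
  have key : ∀ w : Fin k → F, ∑ l, w l * v l = 0 := by
    intro w
    have hw : w ∈ Submodule.span F (Set.range
        (fun j : {x // x ∈ S} => fun i : Fin k => mdsMat F k nA α i j.1)) := by
      rw [hsp]; trivial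
    induction hw using Submodule.span_induction with
    | mem x hx =>
      obtain ⟨j, rfl⟩ := hx
      exact h j.1 (hST j.2)
    | zero => simp
    | add x y _ _ hx hy => simp [add_mul, Finset.sum_add_distrib, hx, hy]
    | smul c x _ hx => simp [mul_assoc, ← Finset.mul_sum, hx]
  funext l
  simpa [Pi.single_apply] using key (Pi.single l 1)

theorem aux_mod (k s i : ℕ) (hi : i < k) (hs1 : 1 ≤ s) (hs2 : s < k) : (i + s) % k ≠ i := by
  rcases Nat.lt_or_ge (i + s) k with h | h
  · rw [Nat.mod_eq_of_lt h]; omega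
  · rw [Nat.mod_eq_sub_mod h, Nat.mod_eq_of_lt (by omega)]; omega

theorem aux_mod2 (k a b : ℕ) (hk : 3 ≤ k) (ha : a < k) (hb : b < k) (h : (a + 1) % k = b) :
    (b + 1) % k ≠ a := by
  rcases Nat.lt_or_ge (a + 1) k with h1 | h1
  · rw [Nat.mod_eq_of_lt h1] at h
    rcases Nat.lt_or_ge (b + 1) k with h2 | h2
    · rw [Nat.mod_eq_of_lt h2]; omega
    · rw [Nat.mod_eq_sub_mod h2, Nat.mod_eq_of_lt (by omega)]; omega
  · rw [Nat.mod_eq_sub_mod h1, Nat.mod_eq_of_lt (by omega)] at h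
    rw [Nat.mod_eq_of_lt (by omega)]; omega

/-- Since `1 ≤ τ ≤ nA - k - 1`, the Class A code has fault tolerance at
least 2: if the MDS condition holds, then for any set `E` of at most 2 column (node)
indices, any two data matrices whose Class A code arrays agree on every column outside
`E` must be equal. -/
theorem classA_fault_tolerance_two (F : Type*) [Field F] (k nA τ : ℕ)
    (hk : 3 ≤ k) (hnA1 : k + 2 ≤ nA) (hnA2 : nA ≤ 2 * k - 1)
    (hτ1 : 1 ≤ τ) (hτ2 : τ ≤ nA - k - 1)
    (α : Fin k → Fin nA → F) (hMDS : MDSCondition F k nA α) :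
    ∀ E : Finset (Fin nA), E.card ≤ 2 →
      ∀ D D' : Fin k → Fin k → F,
        (∀ (i : Fin k) (j : Fin nA), j ∉ E →
          classACode F k nA τ (by omega) α D i j = classACode F k nA τ (by omega) α D' i j) →
        D = D' := by
  intro E hE D D' hC
  have hk0 : 0 < k := by omega
  obtain ⟨X, hX⟩ : ∃ X : Fin k → Fin k → F, X = fun i l => D i l - D' i l := ⟨_, rfl⟩
  have hXa : ∀ i l, X i l = D i l - D' i l := fun i l => by rw [hX]
  suffices h0 : ∀ i, X i = 0 by
    funext i l
    have := congrFun (h0 i) l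
    rw [hXa] at this
    exact sub_eq_zero.mp this
  -- zero data columns
  have hdata : ∀ i l : Fin k, (⟨l, by omega⟩ : Fin nA) ∉ E → X i l = 0 := by
    intro i l hl
    have := hC i _ hl
    simp only [classACode, l.2, dif_pos] at this
    rw [hXa, this, sub_self]
  have H : ∀ (i : Fin k) (j : Fin nA), j ∉ E →
      ((j : ℕ) < nA - τ ∨ X ⟨((i : ℕ) + (j : ℕ) + τ + 1 - nA) % k, Nat.mod_lt _ hk0⟩ i = 0) →
      ∑ l, mdsMat F k nA α l j * X i l = 0 := by
    intro i j hj hor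
    have hc := hC i j hj
    by_cases hjk : (j : ℕ) < k
    · have h1 := hdata i ⟨j, hjk⟩ hj
      apply Finset.sum_eq_zero
      intro l _
      by_cases hl : (l : ℕ) = j
      · have : l = ⟨j, hjk⟩ := Fin.ext hl
        rw [this, h1, mul_zero]
      · simp [mdsMat, hjk, hl]
    · have e : ∑ l, mdsMat F k nA α l j * X i l
          = ∑ l, α l j * D i l - ∑ l, α l j * D' i l := by
        rw [← Finset.sum_sub_distrib]
        apply Finset.sum_congr rfl
        intro l _
        simp only [mdsMat, hjk, if_false, hXa]
        ring
      rw [e]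
      simp only [classACode, hjk, dif_neg, not_false_eq_true] at hc
      by_cases hjt : (j : ℕ) < nA - τ
      · simp only [hjt, if_true] at hc
        rw [hc, sub_self]
      · simp only [hjt, if_false] at hc
        have h2 := hor.resolve_left hjt
        rw [hXa] at h2
        linear_combination hc - h2
  have hEc : k ≤ (Finset.univ \ E).card := by
    have := Finset.le_card_sdiff E Finset.univ
    rw [Finset.card_univ, Fintype.card_fin] at this
    omega
  have S1 : ∀ i : Fin k, (⟨i, by omega⟩ : Fin nA) ∉ E → X i = 0 := by
    intro i hi
    apply aux_mds F k nA α hMDS _ hEc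
    intro j hj
    exact H i j (by simpa using hj) (Or.inr (hdata _ i hi))
  have S2 : ∀ i : Fin k, (∀ i', i' ≠ i → X i' = 0) → X i = 0 := by
    intro i hi
    apply aux_mds F k nA α hMDS _ hEc
    intro j hj
    refine H i j (by simpa using hj) ?_
    by_cases hjt : (j : ℕ) < nA - τ
    · exact Or.inl hjt
    · right
      rw [hi _ ?_]
      · rfl
      · intro h
        have h' := congrArg Fin.val h
        have hjlt := j.2
        have h3 := aux_mod k ((j : ℕ) + τ + 1 - nA) i i.2 (by omega) (by omega)
        apply h3
        rw [← Nat.add_sub_assoc (by omega)]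
        simpa [add_assoc] using h'
  have S3 : ∀ a b : Fin k, a ≠ b → (⟨a, by omega⟩ : Fin nA) ∈ E → (⟨b, by omega⟩ : Fin nA) ∈ E →
      ((a : ℕ) + 1) % k ≠ b → X a = 0 := by
    intro a b hab ha hb hmod
    have hEeq : ({(⟨a, by omega⟩ : Fin nA), (⟨b, by omega⟩ : Fin nA)} : Finset (Fin nA)) = E := by
      apply Finset.eq_of_subset_of_card_le
      · intro x hx
        simp only [Finset.mem_insert, Finset.mem_singleton] at hx
        rcases hx with rfl | rfl <;> assumption
      · rw [Finset.card_pair]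
        · exact hE
        · intro h
          exact hab (Fin.ext (by simpa using h))
    let U : Finset (Fin nA) := insert (⟨nA - τ, by omega⟩ : Fin nA) (Finset.Iic ⟨k, by omega⟩)
    have hU : U.card = k + 2 := by
      rw [Finset.card_insert_of_notMem]
      · simp
      · simp only [Finset.mem_Iic, Fin.mk_le_mk]; omega
    have hUc : k ≤ (U \ E).card := by
      have := Finset.le_card_sdiff E U
      omega
    apply aux_mds F k nA α hMDS _ hUc
    intro j hj
    rw [Finset.mem_sdiff] at hj
    refine H a j hj.2 ?_
    rcases Finset.mem_insert.mp hj.1 with h | h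
    · right
      have hidx : ((a : ℕ) + (j : ℕ) + τ + 1 - nA) = a + 1 := by
        rw [h]; simp only; omega
      have hz := aux_mod k 1 a a.2 (by omega) (by omega)
      rw [S1 _ ?_]
      · rfl
      · rw [← hEeq]
        simp only [hidx, Finset.mem_insert, Finset.mem_singleton, Fin.mk.injEq, not_or]
        exact ⟨hz, hmod⟩
    · left
      rw [Finset.mem_Iic, Fin.le_def] at h
      simp only at h
      omega
  intro a
  apply S2
  intro b hba
  by_contra hb
  have hbE : (⟨b, by omega⟩ : Fin nA) ∈ E := by
    by_contra h; exact hb (S1 b h)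
  apply hb
  apply S2
  intro c hcb
  by_contra hc
  have hcE : (⟨c, by omega⟩ : Fin nA) ∈ E := by
    by_contra h; exact hc (S1 c h)
  by_cases hm : ((b : ℕ) + 1) % k = c
  · exact hc (S3 c b hcb hcE hbE (aux_mod2 k b c hk b.2 c.2 hm))
  · exact hb (S3 b c hcb.symm hbE hcE hm)
end

section
/- A single piggybacked parity node repairs any single systematic node failure: let u = n_A − τ be the first piggybacked parity column and fix r ∈ {0, …, k−1} with α_{r,u} ≠ 0. If D and D′ are k×k data matrices over F such that D_{i,l} = D′_{i,l} for all i and all l ≠ r, and the Class A code arrays of D and D′ agree on the entire column u, then D = D′. -/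
/-- A single piggybacked parity node repairs any single systematic node
failure: let `u = nA - τ` be the first piggybacked parity column and suppose
`α_{r,u} ≠ 0`. If two data matrices agree on all data columns `l ≠ r` and their Class A
code arrays agree on the whole column `u`, then they are equal. -/
theorem piggyback_single_node_repair (F : Type*) [Field F] (k nA τ : ℕ)
    (hk : 3 ≤ k) (hnA1 : k + 2 ≤ nA) (hnA2 : nA ≤ 2 * k - 1)
    (hτ1 : 1 ≤ τ) (hτ2 : τ ≤ nA - k - 1)
    (α : Fin k → Fin nA → F) (r : Fin k)
    (hα : α r ⟨nA - τ, by omega⟩ ≠ 0)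
    (D D' : Fin k → Fin k → F)
    (hdata : ∀ (i l : Fin k), l ≠ r → D i l = D' i l)
    (hcol : ∀ i : Fin k,
      classACode F k nA τ (by omega) α D i ⟨nA - τ, by omega⟩
        = classACode F k nA τ (by omega) α D' i ⟨nA - τ, by omega⟩) :
    D = D' := by
  have hu1 : ¬ (nA - τ < k) := by omega
  have key : ∀ i : Fin k,
      α r ⟨nA - τ, by omega⟩ * (D i r - D' i r)
        + (D ⟨((i : ℕ) + (nA - τ) + τ + 1 - nA) % k, Nat.mod_lt _ (by omega)⟩ i
          - D' ⟨((i : ℕ) + (nA - τ) + τ + 1 - nA) % k, Nat.mod_lt _ (by omega)⟩ i) = 0 := by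
    intro i
    have h := hcol i
    simp only [classACode, hu1, lt_irrefl, dite_false, if_false] at h
    have hs : (∑ l : Fin k, α l ⟨nA - τ, by omega⟩ * D i l)
        - (∑ l : Fin k, α l ⟨nA - τ, by omega⟩ * D' i l)
        = α r ⟨nA - τ, by omega⟩ * (D i r - D' i r) := by
      rw [← Finset.sum_sub_distrib, Finset.sum_eq_single r]
      · ring
      · intro l _ hl
        rw [hdata i l hl, sub_self]
      · intro hr
        exact absurd (Finset.mem_univ r) hr
    rw [← hs]
    linear_combination h
  have step : ∀ i : Fin k,
      D ⟨((i : ℕ) + (nA - τ) + τ + 1 - nA) % k, Nat.mod_lt _ (by omega)⟩ i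
        = D' ⟨((i : ℕ) + (nA - τ) + τ + 1 - nA) % k, Nat.mod_lt _ (by omega)⟩ i →
      D i r = D' i r := by
    intro i h
    have hk' := key i
    rw [h, sub_self, add_zero] at hk'
    exact sub_eq_zero.mp ((mul_eq_zero.mp hk').resolve_left hα)
  have hne : ∀ i : Fin k, i ≠ r → D i r = D' i r :=
    fun i hi => step i (hdata _ i hi)
  have hrr : D r r = D' r r := by
    apply step r
    apply hne
    intro h
    have h2 := congrArg Fin.val h
    have h3 : (r : ℕ) + (nA - τ) + τ + 1 - nA = r + 1 := by omega
    simp only [h3] at h2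
    have hr := r.isLt
    rcases Nat.lt_or_ge ((r : ℕ) + 1) k with h4 | h4
    · rw [Nat.mod_eq_of_lt h4] at h2
      omega
    · have h5 : (r : ℕ) + 1 = k := by omega
      rw [h5, Nat.mod_self] at h2
      omega
  funext i l
  by_cases hl : l = r
  · subst hl
    by_cases hi : i = l
    · subst hi
      exact hrr
    · exact hne i hi
  · exact hdata i l hl
end

section
/- Correctness of the Class A decoding schedule: fix j ∈ {0, …, k−1} with α_{j,k} ≠ 0. If D and D′ are k×k data matrices over F that agree at all entries (j, l) with l ≠ j (the k−1 surviving data symbols of row j after failure of node j), and their Class A code arrays agree at position (j, k) and at positions (j, u) for every u = n_A − τ, …, n_A − 1 (the τ + 1 parity symbols read in row j), then D_{(j+s) mod k, j} = D′_{(j+s) mod k, j} for all s = 0, …, τ. That is, reading the k−1 surviving data symbols of row j together with τ + 1 parity symbols of row j uniquely determines τ + 1 symbols of the failed node j. -/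
/-- Correctness of the Class A decoding schedule. Fix `j` with
`α_{j,k} ≠ 0`. If two data matrices agree at all entries `(j, l)` with `l ≠ j` (the
`k - 1` surviving data symbols of row `j` after failure of node `j`), and their Class A
code arrays agree at position `(j, k)` and at positions `(j, u)` for every piggybacked
column `u = nA - τ, …, nA - 1`, then `D_{(j+s) mod k, j} = D'_{(j+s) mod k, j}` for all
`s = 0, …, τ`: the read symbols uniquely determine `τ + 1` symbols of the failed node. -/
theorem classA_decoding_schedule (F : Type*) [Field F] (k nA τ : ℕ)
    (hk : 3 ≤ k) (hnA1 : k + 2 ≤ nA) (hnA2 : nA ≤ 2 * k - 1)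
    (hτ1 : 1 ≤ τ) (hτ2 : τ ≤ nA - k - 1)
    (α : Fin k → Fin nA → F) (j : Fin k)
    (hα : α j ⟨k, by omega⟩ ≠ 0)
    (D D' : Fin k → Fin k → F)
    (hdata : ∀ l : Fin k, l ≠ j → D j l = D' j l)
    (hpar : classACode F k nA τ (by omega) α D j ⟨k, by omega⟩
              = classACode F k nA τ (by omega) α D' j ⟨k, by omega⟩)
    (hpig : ∀ u : Fin nA, nA - τ ≤ (u : ℕ) →
      classACode F k nA τ (by omega) α D j u = classACode F k nA τ (by omega) α D' j u) :
    ∀ s : ℕ, s ≤ τ →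
      D ⟨((j : ℕ) + s) % k, Nat.mod_lt _ (by omega)⟩ j
        = D' ⟨((j : ℕ) + s) % k, Nat.mod_lt _ (by omega)⟩ j := by
  have hjj : D j j = D' j j := by
    have h1 : k < nA - τ := by omega
    simp only [classACode, lt_irrefl, dite_false, h1, if_true] at hpar
    rw [← Finset.add_sum_erase _ _ (Finset.mem_univ j),
      ← Finset.add_sum_erase _ (fun l => α l _ * D' j l) (Finset.mem_univ j)] at hpar
    have h2 : ∀ l ∈ Finset.univ.erase j,
        α l ⟨k, by omega⟩ * D j l = α l ⟨k, by omega⟩ * D' j l := by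
      intro l hl
      rw [hdata l (Finset.ne_of_mem_erase hl)]
    rw [Finset.sum_congr rfl h2] at hpar
    exact mul_left_cancel₀ hα (add_right_cancel hpar)
  have hrow : ∀ l, D j l = D' j l := by
    intro l
    by_cases h : l = j
    · rw [h, hjj]
    · exact hdata l h
  intro s hs
  rcases Nat.eq_zero_or_pos s with rfl | hpos
  · have h0 : (⟨((j : ℕ) + 0) % k, Nat.mod_lt _ (by omega)⟩ : Fin k) = j := by
      apply Fin.ext
      simp [Nat.mod_eq_of_lt j.isLt]
    rw [h0, hjj]
  · have h := hpig ⟨nA - τ + s - 1, by omega⟩ (by simp only; omega)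
    have h1 : ¬ (nA - τ + s - 1 < k) := by omega
    have h2 : ¬ (nA - τ + s - 1 < nA - τ) := by omega
    have h3 : (j : ℕ) + (nA - τ + s - 1) + τ + 1 - nA = j + s := by omega
    simp only [classACode, h1, h2, dite_false, if_false, h3, hrow] at h
    exact add_left_cancel h
end
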